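/- arXiv:2002.12915 — 2 statements merged into one kernel-verified Lean document; each statement's English description precedes it below -/
import Mathlib

section
/- Let c, d, n be positive integers, let x₁,…,xₙ ∈ ℝ^d be nonzero vectors with labels y₁,…,yₙ, let ℓ be a continuous nonnegative loss, B > 0, σ > 0, A > 0, r > 0, and define the function class 𝓛̂_σ(r) = {ℓ̃_σ(W,·,·) : W ∈ ℝ^{c×d}, ‖Wᵀ‖_{2,1} ≤ A, (1/n) Σ_i ℓ̃_σ(W,x_i,y_i) ≤ r}. Then for every ε > 0 there exists a finite subset S ⊆ 𝓛̂_σ(r) with log|S| ≤ 1152·⌊4A²/ε²⌋·(log₂(2·⌈16A/ε + 2⌉·n + 1) + log c) such that every f ∈ 𝓛̂_σ(r) satisfies ‖f − g‖_{L₂(Pₙ)} ≤ (√(8Br)/σ)·ε for some g ∈ S. -/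
open MeasureTheory

/-- The quadratic ramp penalty truncated at `σ`. -/
noncomputable def sPen (σ t : ℝ) : ℝ := if t < σ then (1 - t / σ) ^ 2 else 0

/-- `W x` as a vector in Euclidean space. -/
noncomputable def mulVecE {c d : ℕ} (W : Matrix (Fin c) (Fin d) ℝ)
    (x : EuclideanSpace ℝ (Fin d)) : EuclideanSpace ℝ (Fin c) :=
  (WithLp.equiv 2 (Fin c → ℝ)).symm (W.mulVec ((WithLp.equiv 2 (Fin d → ℝ)) x))

/-- `‖Wᵀ‖_{2,1}`: the sum of the Euclidean norms of the rows of `W`. -/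
noncomputable def rowNormSum {c d : ℕ} (W : Matrix (Fin c) (Fin d) ℝ) : ℝ :=
  ∑ i, ‖((WithLp.equiv 2 (Fin d → ℝ)).symm (W i))‖

/-- The perturbed truncated loss
`ℓ̃_σ(W,x,y) = sup_δ s_σ(‖δ‖₂) · min{B, ℓ(Wx + ‖x‖₂ δ, y)}`. -/
noncomputable def ellTilde {c d : ℕ} (ℓ : EuclideanSpace ℝ (Fin c) → Fin c → ℝ) (B σ : ℝ)
    (W : Matrix (Fin c) (Fin d) ℝ) (x : EuclideanSpace ℝ (Fin d)) (y : Fin c) : ℝ :=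
  ⨆ δ : EuclideanSpace ℝ (Fin c), sPen σ ‖δ‖ * min B (ℓ (mulVecE W x + ‖x‖ • δ) y)

open scoped Pointwise InnerProductSpace

/-- Greedy (perceptron-type) approximation: a vector of squared norm at most `N η²` agrees up to `η`
on all the unit vectors `x i` with a sum of `N` terms from `{0, ±η x i}`. -/
lemma exists_greedy_approx {ι E M : Type*} [NormedAddCommGroup E] [InnerProductSpace ℝ E]
    [AddCommMonoid M] (x : ι → E) (hx : ∀ i, ‖x i‖ = 1) (φ : E →+ M) (G : Set M)
    (h0 : (0 : M) ∈ G) (η : ℝ) (hη : 0 ≤ η) (hp : ∀ i, φ (η • x i) ∈ G)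
    (hm : ∀ i, φ (-(η • x i)) ∈ G) (N : ℕ) (w : E) (hw : ‖w‖ ^ 2 ≤ N * η ^ 2) :
    ∃ z, φ z ∈ N • G ∧ ∀ i, |⟪x i, w - z⟫_ℝ| ≤ η := by
  induction N generalizing w with
  | zero =>
    have hw0 : w = 0 := by
      have : ‖w‖ ^ 2 ≤ 0 := by simpa using hw
      exact norm_eq_zero.mp (pow_eq_zero_iff two_ne_zero |>.mp (le_antisymm this (sq_nonneg _)))
    exact ⟨0, by simp, fun i => by simp [hw0, hη]⟩
  | succ N ih =>
    by_cases hall : ∀ i, |⟪x i, w⟫_ℝ| ≤ η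
    · exact ⟨0, by rw [map_zero]; exact Set.zero_mem_nsmul h0, by simpa using hall⟩
    · push Not at hall
      obtain ⟨i, hi⟩ := hall
      obtain ⟨u, hu, hG⟩ : ∃ u : E, ‖w - u‖ ^ 2 ≤ N * η ^ 2 ∧ φ u ∈ G := by
        push_cast at hw
        have hnorm : ‖η • x i‖ ^ 2 = η ^ 2 := by rw [norm_smul, hx i]; simp
        have hinner : ⟪w, η • x i⟫_ℝ = η * ⟪x i, w⟫_ℝ := by
          rw [inner_smul_right, real_inner_comm]
        rcases lt_abs.mp hi with h | h
        · refine ⟨η • x i, ?_, hp i⟩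
          rw [norm_sub_sq_real, hnorm, hinner]
          nlinarith
        · refine ⟨-(η • x i), ?_, hm i⟩
          rw [sub_neg_eq_add, norm_add_sq_real, hnorm, hinner]
          nlinarith
      obtain ⟨z, hz, hzi⟩ := ih (w - u) hu
      refine ⟨z + u, ?_, fun j => ?_⟩
      · rw [map_add, succ_nsmul]
        exact Set.add_mem_add hz hG
      · rw [show w - (z + u) = w - u - z by abel]
        exact hzi j

lemma Set.sum_mem_sum_nsmul {κ M : Type*} [AddCommMonoid M] (G : Set M) (s : Finset κ)
    (N : κ → ℕ) (z : κ → M) (h : ∀ y ∈ s, z y ∈ N y • G) :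
    ∑ y ∈ s, z y ∈ (∑ y ∈ s, N y) • G := by
  classical
  induction s using Finset.induction_on with
  | empty => simp
  | insert a s ha ih =>
    rw [Finset.sum_insert ha, Finset.sum_insert ha, add_nsmul]
    exact Set.add_mem_add (h a (Finset.mem_insert_self a s))
      (ih fun y hy => h y (Finset.mem_insert_of_mem hy))

/-- A dimension-free net, uniform over the unit vectors `x i`, for families of vectors whose norms
sum to at most `A`. -/
lemma exists_rows_net {ι κ E : Type*} [Fintype ι] [Nonempty ι] [Fintype κ] [Nonempty κ]
    [NormedAddCommGroup E] [InnerProductSpace ℝ E] (x : ι → E) (hx : ∀ i, ‖x i‖ = 1)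
    (A η : ℝ) (hA : 0 < A) (hη : 0 < η) :
    ∃ T : Finset (κ → E),
      T.card ≤ (3 * Fintype.card κ * Fintype.card ι * (⌊A ^ 2 / η ^ 2⌋₊ + 1)) ^
        (4 * ⌊A ^ 2 / η ^ 2⌋₊) ∧
      ∀ w : κ → E, ∑ y, ‖w y‖ ≤ A →
        ∃ z ∈ T, ∀ i, ∑ y, ⟪x i, w y - z y⟫_ℝ ^ 2 ≤ η ^ 2 := by
  classical
  set K := ⌊A ^ 2 / η ^ 2⌋₊ with hK
  let q : ℕ → ℝ := fun k => η ^ 2 / A * √k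
  let atom : κ × ι × SignType × Fin (K + 1) → κ → E := fun a =>
    Pi.single a.1 (((a.2.2.1 : ℝ) * q a.2.2.2) • x a.2.1)
  let G : Finset (κ → E) := Finset.univ.image atom
  have hGcard : G.card ≤ 3 * Fintype.card κ * Fintype.card ι * (K + 1) := by
    refine Finset.card_image_le.trans (le_of_eq ?_)
    have h3 : Fintype.card SignType = 3 := rfl
    simp only [Finset.card_univ, Fintype.card_prod, Fintype.card_fin, h3]
    ring
  have hatom : ∀ a, atom a ∈ G := fun a => Finset.mem_image_of_mem _ (Finset.mem_univ a)
  have h0 : (0 : κ → E) ∈ (G : Set (κ → E)) := by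
    have := hatom (Classical.arbitrary κ, Classical.arbitrary ι, 0, 0)
    simpa [atom] using this
  refine ⟨(4 * K) • G, Finset.card_nsmul_le.trans (Nat.pow_le_pow_left hGcard _), fun w hw => ?_⟩
  let k : κ → ℕ := fun y => ⌊‖w y‖ * A / η ^ 2⌋₊
  have hk_le : ∀ y, (k y : ℝ) ≤ ‖w y‖ * A / η ^ 2 := fun y => Nat.floor_le (by positivity)
  have hk_lt : ∀ y, ‖w y‖ * A / η ^ 2 < k y + 1 := fun y => Nat.lt_floor_add_one _
  have hk_sum : ∑ y, k y ≤ K := by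
    refine Nat.le_floor ?_
    push_cast
    calc ∑ y, (k y : ℝ) ≤ ∑ y, ‖w y‖ * A / η ^ 2 := Finset.sum_le_sum fun y _ => hk_le y
      _ = (∑ y, ‖w y‖) * (A / η ^ 2) := by rw [Finset.sum_mul]; simp only [mul_div_assoc]
      _ ≤ A * (A / η ^ 2) := by gcongr
      _ = A ^ 2 / η ^ 2 := by ring
  have hrow : ∀ y, ∃ z : E, (Pi.single y z : κ → E) ∈ (4 * k y) • (G : Set (κ → E)) ∧
      ∀ i, ⟪x i, w y - z⟫_ℝ ^ 2 ≤ η ^ 2 / A * ‖w y‖ := by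
    intro y
    have hlow := hk_le y
    have hup := hk_lt y
    rw [le_div_iff₀ (by positivity)] at hlow
    rw [div_lt_iff₀ (by positivity)] at hup
    rcases Nat.eq_zero_or_pos (k y) with hky | hky
    · refine ⟨0, by simp [hky], fun i => ?_⟩
      have h1 : |⟪x i, w y⟫_ℝ| ≤ ‖w y‖ := by
        simpa [hx i] using abs_real_inner_le_norm (x i) (w y)
      have h2 : ‖w y‖ ≤ η ^ 2 / A := by
        rw [le_div_iff₀ hA]
        simp only [hky, Nat.cast_zero] at hup
        linarith
      rw [sub_zero, ← sq_abs]
      nlinarith [abs_nonneg ⟪x i, w y⟫_ℝ, norm_nonneg (w y)]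
    · have hkK : k y < K + 1 :=
        Nat.lt_succ_of_le ((Finset.single_le_sum (fun _ _ => Nat.zero_le _)
          (Finset.mem_univ y)).trans hk_sum)
      have hk1 : (1 : ℝ) ≤ k y := by exact_mod_cast hky
      have hqsq : q (k y) ^ 2 = (η ^ 2 / A) ^ 2 * k y := by
        simp only [q]
        rw [mul_pow, Real.sq_sqrt (Nat.cast_nonneg _)]
      have hwy : ‖w y‖ ≤ (k y + 1) * (η ^ 2 / A) := by
        rw [← mul_div_assoc, le_div_iff₀ hA]
        exact hup.le
      obtain ⟨z, hz, hzi⟩ := exists_greedy_approx x hx (AddMonoidHom.single (fun _ : κ => E) y)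
        (G : Set (κ → E)) h0 (q (k y)) (by positivity)
        (fun i => by simpa [atom] using hatom (y, i, 1, ⟨k y, hkK⟩))
        (fun i => by simpa [atom] using hatom (y, i, -1, ⟨k y, hkK⟩)) (4 * k y) (w y) (by
          rw [hqsq]
          push_cast
          calc ‖w y‖ ^ 2 ≤ ((k y + 1) * (η ^ 2 / A)) ^ 2 := by gcongr
            _ = (k y + 1) ^ 2 * (η ^ 2 / A) ^ 2 := by ring
            _ ≤ (4 * k y * k y) * (η ^ 2 / A) ^ 2 := by gcongr; nlinarith
            _ = _ := by ring)
      refine ⟨z, by simpa using hz, fun i => ?_⟩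
      calc ⟪x i, w y - z⟫_ℝ ^ 2 ≤ q (k y) ^ 2 := sq_le_sq' (abs_le.mp (hzi i)).1 (abs_le.mp (hzi i)).2
        _ = η ^ 2 / A * (k y * η ^ 2 / A) := by rw [hqsq]; ring
        _ ≤ η ^ 2 / A * ‖w y‖ := by
          gcongr
          rw [div_le_iff₀ hA]
          exact hlow
  choose z hz hzi using hrow
  refine ⟨z, ?_, fun i => ?_⟩
  · rw [← Finset.mem_coe, Finset.coe_nsmul, ← Finset.univ_sum_single z]
    refine Set.nsmul_subset_nsmul_right h0 ?_
      (Set.sum_mem_sum_nsmul (G : Set (κ → E)) Finset.univ (fun y => 4 * k y) _ fun y _ => hz y)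
    rw [← Finset.mul_sum]
    exact Nat.mul_le_mul_left 4 hk_sum
  · calc ∑ y, ⟪x i, w y - z y⟫_ℝ ^ 2 ≤ ∑ y, η ^ 2 / A * ‖w y‖ := Finset.sum_le_sum fun y _ => hzi y i
      _ = η ^ 2 / A * ∑ y, ‖w y‖ := by rw [Finset.mul_sum]
      _ ≤ η ^ 2 / A * A := by gcongr
      _ = η ^ 2 := by field_simp

section PerturbedLoss

variable {c d : ℕ} {ℓ : EuclideanSpace ℝ (Fin c) → Fin c → ℝ} {B σ : ℝ}

lemma sPen_nonneg (σ t : ℝ) : 0 ≤ sPen σ t := by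
  unfold sPen; split_ifs <;> positivity

lemma sPen_le_one (hσ : 0 < σ) {t : ℝ} (ht : 0 ≤ t) : sPen σ t ≤ 1 := by
  unfold sPen
  split_ifs with h
  · have h1 : t / σ ≤ 1 := by rw [div_le_one hσ]; exact h.le
    have h2 : 0 ≤ t / σ := by positivity
    nlinarith
  · exact zero_le_one

lemma ellTilde_bddAbove (hB : 0 < B) (hσ : 0 < σ)
    (hnonneg : ∀ v y, 0 ≤ ℓ v y) (W : Matrix (Fin c) (Fin d) ℝ) (x : EuclideanSpace ℝ (Fin d))
    (y : Fin c) :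
    BddAbove (Set.range fun δ : EuclideanSpace ℝ (Fin c) =>
      sPen σ ‖δ‖ * min B (ℓ (mulVecE W x + ‖x‖ • δ) y)) := by
  refine ⟨B, ?_⟩
  rintro _ ⟨δ, rfl⟩
  calc sPen σ ‖δ‖ * min B (ℓ (mulVecE W x + ‖x‖ • δ) y) ≤ 1 * B :=
        mul_le_mul (sPen_le_one hσ (norm_nonneg _)) (min_le_left _ _)
          (le_min hB.le (hnonneg _ _)) zero_le_one
    _ = B := one_mul B

lemma ellTilde_nonneg (hB : 0 < B) (hnonneg : ∀ v y, 0 ≤ ℓ v y)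
    (W : Matrix (Fin c) (Fin d) ℝ) (x : EuclideanSpace ℝ (Fin d)) (y : Fin c) :
    0 ≤ ellTilde ℓ B σ W x y :=
  Real.iSup_nonneg fun _ => mul_nonneg (sPen_nonneg _ _) (le_min hB.le (hnonneg _ _))

lemma sqrt_ellTilde_le (hB : 0 < B) (hσ : 0 < σ) (hnonneg : ∀ v y, 0 ≤ ℓ v y)
    (W W' : Matrix (Fin c) (Fin d) ℝ) {x : EuclideanSpace ℝ (Fin d)} (hx : x ≠ 0) (y : Fin c)
    {h : ℝ} (hW : ‖mulVecE W x - mulVecE W' x‖ ≤ h * ‖x‖) :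
    √(ellTilde ℓ B σ W x y) ≤ √(ellTilde ℓ B σ W' x y) + √B / σ * h := by
  have hx' : 0 < ‖x‖ := norm_pos_iff.mpr hx
  have hh : 0 ≤ h := nonneg_of_mul_nonneg_left ((norm_nonneg _).trans hW) hx'
  rw [Real.sqrt_le_left (by positivity)]
  refine ciSup_le fun δ => ?_
  by_cases hδ : ‖δ‖ < σ
  swap
  · simp only [sPen, if_neg hδ, zero_mul]
    positivity
  set δ' := δ + ‖x‖⁻¹ • (mulVecE W x - mulVecE W' x) with hδ'
  have hshift : mulVecE W x + ‖x‖ • δ = mulVecE W' x + ‖x‖ • δ' := by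
    rw [hδ', smul_add, smul_inv_smul₀ hx'.ne']
    abel
  have hnorm : ‖δ'‖ ≤ ‖δ‖ + h := by
    refine (norm_add_le _ _).trans (by
      gcongr
      rw [norm_smul, norm_inv, norm_norm, inv_mul_le_iff₀ hx', mul_comm]
      exact hW)
  rw [hshift]
  set u := min B (ℓ (mulVecE W' x + ‖x‖ • δ') y) with hu
  have hu0 : 0 ≤ u := le_min hB.le (hnonneg _ _)
  have hle : sPen σ ‖δ'‖ * u ≤ ellTilde ℓ B σ W' x y :=
    le_ciSup (ellTilde_bddAbove hB hσ hnonneg W' x y) δ'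
  have huB : √u ≤ √B := Real.sqrt_le_sqrt (min_le_left _ _)
  have hmain : (1 - ‖δ'‖ / σ) * √u ≤ √(ellTilde ℓ B σ W' x y) := by
    by_cases hs : ‖δ'‖ < σ
    · refine Real.le_sqrt_of_sq_le ?_
      rw [mul_pow, Real.sq_sqrt hu0]
      simpa only [sPen, if_pos hs] using hle
    · have : 1 - ‖δ'‖ / σ ≤ 0 := by
        rw [sub_nonpos, one_le_div hσ]
        exact not_lt.mp hs
      exact (mul_nonpos_of_nonpos_of_nonneg this (Real.sqrt_nonneg _)).trans (Real.sqrt_nonneg _)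
  have h1 : 0 ≤ 1 - ‖δ‖ / σ := by
    rw [sub_nonneg, div_le_one hσ]
    exact hδ.le
  have h2 : (1 - ‖δ‖ / σ) * √u ≤ √(ellTilde ℓ B σ W' x y) + √B / σ * h := by
    have h3 : 1 - ‖δ‖ / σ ≤ (1 - ‖δ'‖ / σ) + h / σ := by
      have : ‖δ'‖ / σ ≤ (‖δ‖ + h) / σ := by gcongr
      rw [add_div] at this
      linarith
    calc (1 - ‖δ‖ / σ) * √u ≤ ((1 - ‖δ'‖ / σ) + h / σ) * √u := by gcongr
      _ = (1 - ‖δ'‖ / σ) * √u + h / σ * √u := by ring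
      _ ≤ √(ellTilde ℓ B σ W' x y) + h / σ * √B := by gcongr
      _ = _ := by ring
  calc sPen σ ‖δ‖ * u = ((1 - ‖δ‖ / σ) * √u) ^ 2 := by
        rw [mul_pow, Real.sq_sqrt hu0]
        simp only [sPen, if_pos hδ]
    _ ≤ _ := by gcongr

/-- The perturbed truncated loss is self-bounding Lipschitz in the scores. -/
lemma sq_ellTilde_sub_le (hB : 0 < B) (hσ : 0 < σ) (hnonneg : ∀ v y, 0 ≤ ℓ v y)
    (W W' : Matrix (Fin c) (Fin d) ℝ) {x : EuclideanSpace ℝ (Fin d)} (hx : x ≠ 0) (y : Fin c)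
    {h : ℝ} (hW : ‖mulVecE W x - mulVecE W' x‖ ≤ h * ‖x‖) :
    (ellTilde ℓ B σ W x y - ellTilde ℓ B σ W' x y) ^ 2 ≤
      2 * B * h ^ 2 / σ ^ 2 * (ellTilde ℓ B σ W x y + ellTilde ℓ B σ W' x y) := by
  have h1 := sqrt_ellTilde_le hB hσ hnonneg W W' hx y hW
  have h2 := sqrt_ellTilde_le hB hσ hnonneg W' W hx y (by rwa [norm_sub_rev] at hW)
  have ha := Real.sq_sqrt (ellTilde_nonneg (σ := σ) hB hnonneg W x y)
  have hb := Real.sq_sqrt (ellTilde_nonneg (σ := σ) hB hnonneg W' x y)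
  set a := √(ellTilde ℓ B σ W x y)
  set b := √(ellTilde ℓ B σ W' x y)
  rw [← ha, ← hb]
  have h3 : (a - b) ^ 2 ≤ B * h ^ 2 / σ ^ 2 := by
    calc (a - b) ^ 2 ≤ (√B / σ * h) ^ 2 := sq_le_sq' (by linarith) (by linarith)
      _ = B * h ^ 2 / σ ^ 2 := by rw [mul_pow, div_pow, Real.sq_sqrt hB.le]; ring
  calc (a ^ 2 - b ^ 2) ^ 2 = (a - b) ^ 2 * (a + b) ^ 2 := by ring
    _ ≤ B * h ^ 2 / σ ^ 2 * (2 * (a ^ 2 + b ^ 2)) := by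
      gcongr
      nlinarith [sq_nonneg (a - b)]
    _ = _ := by ring

end PerturbedLoss

lemma norm_sq_mulVecE_sub {c d : ℕ} (W : Matrix (Fin c) (Fin d) ℝ)
    (z : Fin c → EuclideanSpace ℝ (Fin d)) (x : EuclideanSpace ℝ (Fin d)) :
    ‖mulVecE W x - mulVecE (fun y => (z y).ofLp) x‖ ^ 2 =
      ∑ y, ⟪x, WithLp.toLp 2 (W y) - z y⟫_ℝ ^ 2 := by
  rw [EuclideanSpace.real_norm_sq_eq]
  refine Finset.sum_congr rfl fun y _ => ?_
  rw [inner_sub_right, EuclideanSpace.inner_eq_star_dotProduct,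
    EuclideanSpace.inner_eq_star_dotProduct]
  simp [mulVecE, Matrix.mulVec, star_trivial]

/-- A net for the weight matrices, uniform over the sample and relative to `‖x i‖`. -/
lemma exists_matrix_net {c d n : ℕ} (hc : 0 < c) (hn : 0 < n)
    (x : Fin n → EuclideanSpace ℝ (Fin d)) (hx : ∀ i, x i ≠ 0) (A η : ℝ) (hA : 0 < A)
    (hη : 0 < η) :
    ∃ T : Finset (Fin c → EuclideanSpace ℝ (Fin d)),
      T.card ≤ (3 * c * n * (⌊A ^ 2 / η ^ 2⌋₊ + 1)) ^ (4 * ⌊A ^ 2 / η ^ 2⌋₊) ∧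
      ∀ W : Matrix (Fin c) (Fin d) ℝ, rowNormSum W ≤ A →
        ∃ z ∈ T, ∀ i,
          ‖mulVecE W (x i) - mulVecE (fun y => (z y).ofLp) (x i)‖ ≤ η * ‖x i‖ := by
  have : Nonempty (Fin c) := ⟨⟨0, hc⟩⟩
  have : Nonempty (Fin n) := ⟨⟨0, hn⟩⟩
  have hpos : ∀ i, 0 < ‖x i‖ := fun i => norm_pos_iff.mpr (hx i)
  obtain ⟨T, hT, hcov⟩ := exists_rows_net (κ := Fin c) (fun i => ‖x i‖⁻¹ • x i)
    (fun i => by rw [norm_smul, norm_inv, norm_norm, inv_mul_cancel₀ (hpos i).ne']) A η hA hη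
  refine ⟨T, by simpa using hT, fun W hW => ?_⟩
  obtain ⟨z, hz, hzi⟩ := hcov (fun y => WithLp.toLp 2 (W y)) hW
  refine ⟨z, hz, fun i => ?_⟩
  refine le_of_sq_le_sq ?_ (by positivity)
  have := hzi i
  simp only [inner_smul_left, mul_pow, ← Finset.mul_sum] at this
  rw [norm_sq_mulVecE_sub, mul_pow]
  simp only [conj_trivial, inv_pow] at this
  rw [inv_mul_le_iff₀ (by have := hpos i; positivity)] at this
  linarith

lemma log_net_card_le {c n : ℕ} (hc : 0 < c) (hn : 0 < n) {A ε : ℝ} (hA : 0 < A) (hε : 0 < ε) :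
    Real.log (((3 * c * n * (⌊2 * A ^ 2 / ε ^ 2⌋₊ + 1)) ^ (4 * ⌊2 * A ^ 2 / ε ^ 2⌋₊) : ℕ) : ℝ) ≤
      1152 * (⌊4 * A ^ 2 / ε ^ 2⌋ : ℝ) *
        (Real.logb 2 (2 * (⌈16 * A / ε + 2⌉₊ : ℝ) * n + 1) + Real.log c) := by
  set K := ⌊2 * A ^ 2 / ε ^ 2⌋₊ with hK
  set X : ℝ := 2 * (⌈16 * A / ε + 2⌉₊ : ℝ) * n + 1 with hX
  have hn1 : (1 : ℝ) ≤ n := by exact_mod_cast hn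
  have hc1 : (1 : ℝ) ≤ c := by exact_mod_cast hc
  have hKle : (K : ℝ) ≤ 2 * A ^ 2 / ε ^ 2 := Nat.floor_le (by positivity)
  have hKF : (K : ℝ) ≤ (⌊4 * A ^ 2 / ε ^ 2⌋ : ℝ) := by
    have : (K : ℤ) ≤ ⌊4 * A ^ 2 / ε ^ 2⌋ := by
      rw [Int.le_floor]
      refine le_trans (by exact_mod_cast hKle) ?_
      gcongr
      norm_num
    exact_mod_cast this
  set t := A / ε with ht
  have ht0 : 0 < t := by positivity
  have hK2 : (K : ℝ) ≤ 2 * t ^ 2 := by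
    rw [ht, div_pow, ← mul_div_assoc]; exact hKle
  have hXlow : (32 * t + 4) * n ≤ X := by
    have : 16 * A / ε + 2 ≤ (⌈16 * A / ε + 2⌉₊ : ℝ) := Nat.le_ceil _
    rw [mul_div_assoc, ← ht] at this
    rw [hX, mul_div_assoc, ← ht]
    nlinarith
  have hX1 : 1 ≤ X := by nlinarith
  have hn0 : (0 : ℝ) ≤ n := n.cast_nonneg
  have hsq : 3 * n * ((K : ℝ) + 1) ≤ X ^ 2 := by
    calc 3 * n * ((K : ℝ) + 1) ≤ 3 * n * (2 * t ^ 2 + 1) := by gcongr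
      _ ≤ ((32 * t + 4) ^ 2 * n) * 1 := by nlinarith [mul_nonneg ht0.le hn0, mul_nonneg (sq_nonneg t) hn0]
      _ ≤ ((32 * t + 4) ^ 2 * n) * n := by gcongr
      _ = ((32 * t + 4) * n) ^ 2 := by ring
      _ ≤ X ^ 2 := by gcongr
  have hlogX : 0 ≤ Real.log X := Real.log_nonneg hX1
  have hlogb : Real.log X ≤ Real.logb 2 X := by
    rw [Real.logb, le_div_iff₀ (Real.log_pos one_lt_two)]
    nlinarith [Real.log_two_lt_d9]
  have hlogc : 0 ≤ Real.log c := Real.log_nonneg hc1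
  have hlog : Real.log (3 * c * n * ((K : ℝ) + 1)) ≤ 2 * Real.logb 2 X + Real.log c := by
    rw [show (3 * c * n * ((K : ℝ) + 1)) = (3 * n * ((K : ℝ) + 1)) * c by ring,
      Real.log_mul (by positivity) (by positivity)]
    have := Real.log_le_log (by positivity) hsq
    rw [Real.log_pow] at this
    push_cast at this
    linarith
  push_cast
  rw [Real.log_pow]
  push_cast
  calc 4 * (K : ℝ) * Real.log (3 * c * n * ((K : ℝ) + 1))
      ≤ 4 * (K : ℝ) * (2 * Real.logb 2 X + Real.log c) := by gcongr
    _ ≤ 4 * (K : ℝ) * (288 * (Real.logb 2 X + Real.log c)) := by gcongr; linarith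
    _ = 1152 * (K : ℝ) * (Real.logb 2 X + Real.log c) := by ring
    _ ≤ _ := by
      gcongr
      linarith

/-- `L₂(Pₙ)`-covering number bound for the class of perturbed truncated losses
`𝓛̂_σ(r) = {ℓ̃_σ(W,·,·) : ‖Wᵀ‖_{2,1} ≤ A, (1/n)∑ᵢ ℓ̃_σ(W,xᵢ,yᵢ) ≤ r}`. -/
theorem loss_class_cover (c d n : ℕ) (hc : 0 < c) (hd : 0 < d) (hn : 0 < n)
    (x : Fin n → EuclideanSpace ℝ (Fin d)) (hx : ∀ i, x i ≠ 0) (y : Fin n → Fin c)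
    (ℓ : EuclideanSpace ℝ (Fin c) → Fin c → ℝ)
    (hcont : Continuous fun vy : EuclideanSpace ℝ (Fin c) × Fin c => ℓ vy.1 vy.2)
    (hnonneg : ∀ v yy, 0 ≤ ℓ v yy)
    (B σ A r : ℝ) (hB : 0 < B) (hσ : 0 < σ) (hA : 0 < A) (hr : 0 < r) :
    ∀ ε : ℝ, 0 < ε →
      ∃ S : Set ((EuclideanSpace ℝ (Fin d) × Fin c) → ℝ),
        S.Finite ∧
        S ⊆ {f | ∃ W : Matrix (Fin c) (Fin d) ℝ,
          rowNormSum W ≤ A ∧ (1 / n : ℝ) * ∑ i, ellTilde ℓ B σ W (x i) (y i) ≤ r ∧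
          f = fun z => ellTilde ℓ B σ W z.1 z.2} ∧
        Real.log S.ncard ≤
          1152 * (⌊4 * A ^ 2 / ε ^ 2⌋ : ℝ) *
            (Real.logb 2 (2 * (⌈16 * A / ε + 2⌉₊ : ℝ) * n + 1) + Real.log c) ∧
        ∀ f ∈ {f : (EuclideanSpace ℝ (Fin d) × Fin c) → ℝ |
            ∃ W : Matrix (Fin c) (Fin d) ℝ,
              rowNormSum W ≤ A ∧ (1 / n : ℝ) * ∑ i, ellTilde ℓ B σ W (x i) (y i) ≤ r ∧
              f = fun z => ellTilde ℓ B σ W z.1 z.2},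
          ∃ g ∈ S,
            Real.sqrt ((1 / n : ℝ) * ∑ i, (f (x i, y i) - g (x i, y i)) ^ 2) ≤
              Real.sqrt (8 * B * r) / σ * ε := by
  classical
  intro ε hε
  set C : Set (Matrix (Fin c) (Fin d) ℝ) := {W | rowNormSum W ≤ A ∧
    (1 / n : ℝ) * ∑ i, ellTilde ℓ B σ W (x i) (y i) ≤ r} with hC
  have hηsq : (ε / √2) ^ 2 = ε ^ 2 / 2 := by rw [div_pow, Real.sq_sqrt zero_le_two]
  obtain ⟨T, hTcard, hT⟩ := exists_matrix_net hc hn x hx A (ε / √2) hA (by positivity)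
  rw [hηsq, show A ^ 2 / (ε ^ 2 / 2) = 2 * A ^ 2 / ε ^ 2 by field_simp] at hTcard
  let near : Matrix (Fin c) (Fin d) ℝ → (Fin c → EuclideanSpace ℝ (Fin d)) → Prop := fun W z =>
    ∀ i, ‖mulVecE W (x i) - mulVecE (fun y => (z y).ofLp) (x i)‖ ≤ ε / √2 * ‖x i‖
  have hrep : ∀ z, ∃ V, (∃ W ∈ C, near W z) → V ∈ C ∧ near V z := fun z => by
    by_cases h : ∃ W ∈ C, near W z
    · obtain ⟨W, hW, hWz⟩ := h
      exact ⟨W, fun _ => ⟨hW, hWz⟩⟩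
    · exact ⟨0, fun h' => absurd h' h⟩
  choose V hV using hrep
  let F : Matrix (Fin c) (Fin d) ℝ → EuclideanSpace ℝ (Fin d) × Fin c → ℝ := fun W p =>
    ellTilde ℓ B σ W p.1 p.2
  let T' := T.filter fun z => ∃ W ∈ C, near W z
  refine ⟨↑(T'.image fun z => F (V z)), Finset.finite_toSet _, ?_, ?_, ?_⟩
  · intro f hf
    obtain ⟨z, hz, rfl⟩ := Finset.mem_image.mp (Finset.mem_coe.mp hf)
    have := (hV z (Finset.mem_filter.mp hz).2).1
    exact ⟨V z, this.1, this.2, rfl⟩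
  · refine le_trans ?_ (log_net_card_le hc hn hA hε)
    rw [Set.ncard_coe_finset]
    rcases Nat.eq_zero_or_pos (T'.image fun z => F (V z)).card with h | h
    · rw [h, Nat.cast_zero, Real.log_zero]
      exact Real.log_natCast_nonneg _
    · exact Real.log_le_log (by exact_mod_cast h) (by
        exact_mod_cast Finset.card_image_le.trans ((Finset.card_filter_le _ _).trans hTcard))
  · rintro f ⟨W, hWA, hWr, rfl⟩
    obtain ⟨z, hz, hWz⟩ := hT W hWA
    have hex : ∃ W ∈ C, near W z := ⟨W, ⟨hWA, hWr⟩, hWz⟩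
    obtain ⟨⟨-, hVr⟩, hVz⟩ := hV z hex
    refine ⟨F (V z), Finset.mem_coe.mpr
      (Finset.mem_image_of_mem _ (Finset.mem_filter.mpr ⟨hz, hex⟩)), ?_⟩
    have hdist : ∀ i, ‖mulVecE W (x i) - mulVecE (V z) (x i)‖ ≤ √2 * ε * ‖x i‖ := fun i => by
      have h2 : √2 * ε = ε / √2 + ε / √2 := by
        have : √2 * √2 = 2 := Real.mul_self_sqrt zero_le_two
        field_simp
        nlinarith
      have hb := hVz i
      rw [norm_sub_rev] at hb
      rw [h2, add_mul]
      exact (norm_sub_le_norm_sub_add_norm_sub _ _ _).trans (add_le_add (hWz i) hb)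
    rw [Real.sqrt_le_left (by positivity)]
    calc (1 / n : ℝ) * ∑ i, (ellTilde ℓ B σ W (x i) (y i) - ellTilde ℓ B σ (V z) (x i) (y i)) ^ 2
        ≤ (1 / n : ℝ) * ∑ i, 2 * B * (√2 * ε) ^ 2 / σ ^ 2 *
            (ellTilde ℓ B σ W (x i) (y i) + ellTilde ℓ B σ (V z) (x i) (y i)) := by
          gcongr with i
          exact sq_ellTilde_sub_le hB hσ hnonneg W (V z) (hx i) (y i) (hdist i)
      _ = 2 * B * (√2 * ε) ^ 2 / σ ^ 2 *
            ((1 / n : ℝ) * ∑ i, ellTilde ℓ B σ W (x i) (y i) +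
              (1 / n : ℝ) * ∑ i, ellTilde ℓ B σ (V z) (x i) (y i)) := by
          rw [← Finset.mul_sum, Finset.sum_add_distrib]
          ring
      _ ≤ 2 * B * (√2 * ε) ^ 2 / σ ^ 2 * (r + r) := by gcongr
      _ = (√(8 * B * r) / σ * ε) ^ 2 := by
          rw [mul_pow, mul_pow, div_pow, Real.sq_sqrt zero_le_two, Real.sq_sqrt (by positivity)]
          ring
end

section
/- Let c be a positive integer and let ℓ : ℝ^c → ℝ be a convex, three times continuously differentiable function satisfying ‖∇ tr(∇²ℓ(h))‖₂ ≤ τ · tr(∇²ℓ(h)) for all h ∈ ℝ^c and some τ > 0. Then for all h, h' ∈ ℝ^c: ℓ(h') ≤ ℓ(h) + ‖∇ℓ(h)‖₂·‖h' − h‖₂ + tr(∇²ℓ(h)) · (exp(τ·‖h' − h‖₂) − τ·‖h' − h‖₂ − 1)/τ². -/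
/-- The trace of the Hessian of `f` at `v`. -/
noncomputable def hessTrace {c : ℕ} (f : EuclideanSpace ℝ (Fin c) → ℝ)
    (v : EuclideanSpace ℝ (Fin c)) : ℝ :=
  ∑ i, iteratedFDeriv ℝ 2 f v ![EuclideanSpace.single i 1, EuclideanSpace.single i 1]

/-- The directional derivative is the inner product with the gradient, so it is bounded by the
product of the norms. -/
theorem fderiv_apply_le_norm_gradient_mul {E : Type*} [NormedAddCommGroup E]
    [InnerProductSpace ℝ E] [CompleteSpace E] (f : E → ℝ) (x v : E) :
    fderiv ℝ f x v ≤ ‖gradient f x‖ * ‖v‖ := by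
  refine (le_abs_self _).trans (((fderiv ℝ f x).le_opNorm v).trans_eq ?_)
  rw [gradient, LinearIsometryEquiv.norm_map]

theorem hasDerivAt_comp_add_smul {E F : Type*} [NormedAddCommGroup E] [NormedSpace ℝ E]
    [NormedAddCommGroup F] [NormedSpace ℝ F] {f : E → F} (hf : Differentiable ℝ f)
    (x v : E) (t : ℝ) :
    HasDerivAt (fun s : ℝ => f (x + s • v)) (fderiv ℝ f (x + t • v) v) t := by
  have hline : HasDerivAt (fun s : ℝ => x + s • v) v t := by
    simpa using ((hasDerivAt_id t).smul_const v).const_add x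
  exact (hf (x + t • v)).hasFDerivAt.comp_hasDerivAt t hline

/-- The second derivative of a convex function is positive semidefinite. -/
theorem ConvexOn.fderiv_fderiv_nonneg {E : Type*} [NormedAddCommGroup E] [NormedSpace ℝ E]
    {f : E → ℝ} (hconv : ConvexOn ℝ Set.univ f) (hf : ContDiff ℝ 2 f) (x v : E) :
    0 ≤ fderiv ℝ (fderiv ℝ f) x v v := by
  have hf' : Differentiable ℝ (fderiv ℝ f) :=
    (hf.fderiv_right (m := 1) (by norm_num)).differentiable (by norm_num)
  have hd := hasDerivAt_comp_add_smul (hf.differentiable (by norm_num)) x v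
  have hline : ConvexOn ℝ Set.univ (fun s : ℝ => f (x + s • v)) := by
    have h := hconv.comp_affineMap (AffineMap.lineMap x (x + v))
    simpa [Function.comp_def, AffineMap.lineMap_apply, add_comm] using h
  have hmono : Monotone (fun s : ℝ => fderiv ℝ f (x + s • v) v) := by
    have h := hline.monotoneOn_deriv fun t _ => (hd t).differentiableAt
    rw [monotoneOn_univ] at h
    convert h using 1
    exact funext fun t => (hd t).deriv.symm
  have hd2 := (hasDerivAt_comp_add_smul hf' x v 0).clm_apply (hasDerivAt_const (0 : ℝ) v)
  simpa [hd2.deriv] using hmono.deriv_nonneg (x := 0)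

/-- A function with nonpositive derivative on `[0, ∞)` stays below its value at `0`. -/
theorem le_of_hasDerivAt_nonpos {f f' : ℝ → ℝ} (hf : ∀ t, HasDerivAt f (f' t) t)
    (hf' : ∀ t, 0 ≤ t → f' t ≤ 0) {t : ℝ} (ht : 0 ≤ t) : f t ≤ f 0 := by
  refine antitoneOn_of_deriv_nonpos (convex_Ici 0)
    (fun s _ => (hf s).continuousAt.continuousWithinAt)
    (fun s _ => (hf s).differentiableAt.differentiableWithinAt) (fun s hs => ?_)
    Set.self_mem_Ici ht ht
  rw [interior_Ici] at hs
  exact (hf s).deriv ▸ hf' s hs.le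

/-- Grönwall's inequality for `g' ≤ K g`. -/
theorem le_mul_exp_of_hasDerivAt_le {g g' : ℝ → ℝ} {K : ℝ} (hg : ∀ t, HasDerivAt g (g' t) t)
    (hg' : ∀ t, g' t ≤ K * g t) {t : ℝ} (ht : 0 ≤ t) : g t ≤ g 0 * Real.exp (K * t) := by
  have hexp : ∀ s, HasDerivAt (fun s => Real.exp (-(K * s))) (Real.exp (-(K * s)) * -K) s :=
    fun s => by simpa using ((hasDerivAt_id s).const_mul K).neg.exp
  have h := le_of_hasDerivAt_nonpos (fun s => (hg s).mul (hexp s)) (fun s _ => by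
    nlinarith [mul_nonneg (sub_nonneg.2 (hg' s)) (Real.exp_pos (-(K * s))).le]) ht
  simp only [Pi.mul_apply, mul_zero, Real.exp_zero, inv_one, mul_one, Real.exp_neg] at h
  rwa [← div_eq_mul_inv, div_le_iff₀ (Real.exp_pos _)] at h

/-- A positive semidefinite bilinear form is bounded by its trace. -/
theorem bilin_apply_self_le_trace_mul {c : ℕ}
    (B : EuclideanSpace ℝ (Fin c) →L[ℝ] EuclideanSpace ℝ (Fin c) →L[ℝ] ℝ)
    (hB : ∀ v, 0 ≤ B v v) (v : EuclideanSpace ℝ (Fin c)) :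
    B v v ≤ (∑ i, B (EuclideanSpace.single i 1) (EuclideanSpace.single i 1)) * ‖v‖ ^ 2 := by
  set e : Fin c → EuclideanSpace ℝ (Fin c) := fun i => EuclideanSpace.single i 1 with he
  have hv : v = ∑ i, v i • e i := by
    simpa [he] using ((EuclideanSpace.basisFun (Fin c) ℝ).sum_repr v).symm
  have hexpand : B v v = ∑ i, ∑ j, v i * v j * B (e i) (e j) := by
    conv_lhs => rw [hv]
    simp only [map_sum, map_smul, sum_apply, smul_apply,
      smul_eq_mul, Finset.mul_sum]
    rw [Finset.sum_comm]
    exact Finset.sum_congr rfl fun i _ => Finset.sum_congr rfl fun j _ => by ring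
  have hlagrange : 0 ≤ ∑ i, ∑ j, B (v j • e i - v i • e j) (v j • e i - v i • e j) :=
    Finset.sum_nonneg fun i _ => Finset.sum_nonneg fun j _ => hB _
  have hterm : ∀ i j, B (v j • e i - v i • e j) (v j • e i - v i • e j) =
      B (e i) (e i) * v j ^ 2 + B (e j) (e j) * v i ^ 2 - v i * v j * B (e i) (e j)
        - v j * v i * B (e j) (e i) := fun i j => by
    simp only [map_sub, map_smul, sub_apply, smul_apply,
      smul_eq_mul]
    ring
  have htrace : (∑ i, B (e i) (e i)) * ‖v‖ ^ 2 = ∑ i, ∑ j, B (e i) (e i) * v j ^ 2 := by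
    rw [EuclideanSpace.real_norm_sq_eq, Finset.sum_mul_sum]
  simp only [hterm, Finset.sum_sub_distrib, Finset.sum_add_distrib] at hlagrange
  rw [Finset.sum_comm (f := fun i j => B (e j) (e j) * v i ^ 2),
    Finset.sum_comm (f := fun i j => v j * v i * B (e j) (e i)), ← htrace, ← hexpand] at hlagrange
  linarith

theorem hessTrace_eq_sum_fderiv {c : ℕ} (f : EuclideanSpace ℝ (Fin c) → ℝ)
    (v : EuclideanSpace ℝ (Fin c)) :
    hessTrace f v = ∑ i, fderiv ℝ (fderiv ℝ f) v (EuclideanSpace.single i 1)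
      (EuclideanSpace.single i 1) := by
  simp [hessTrace, iteratedFDeriv_two_apply]

theorem ContDiff.differentiable_hessTrace {c : ℕ} {f : EuclideanSpace ℝ (Fin c) → ℝ}
    (hf : ContDiff ℝ 3 f) : Differentiable ℝ (hessTrace f) := by
  have hf'' : Differentiable ℝ (fderiv ℝ (fderiv ℝ f)) :=
    ((hf.fderiv_right (m := 2) (by norm_num)).fderiv_right (m := 1) (by norm_num)).differentiable
      (by norm_num)
  rw [funext (hessTrace_eq_sum_fderiv f)]
  fun_prop

/-- If `ℓ : ℝ^c → ℝ` is convex, `C³`, and `‖∇ tr ∇²ℓ(h)‖ ≤ τ tr ∇²ℓ(h)` for all `h`,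
then `ℓ(h') ≤ ℓ(h) + ‖∇ℓ(h)‖‖h'−h‖ + tr(∇²ℓ(h)) (exp(τ‖h'−h‖) − τ‖h'−h‖ − 1)/τ²`. -/
theorem exp_tail_loss_growth (c : ℕ) (hc : 0 < c) (ℓ : EuclideanSpace ℝ (Fin c) → ℝ)
    (hconv : ConvexOn ℝ Set.univ ℓ) (hsmooth : ContDiff ℝ 3 ℓ) (τ : ℝ) (hτ : 0 < τ)
    (hself : ∀ h : EuclideanSpace ℝ (Fin c),
      ‖gradient (hessTrace ℓ) h‖ ≤ τ * hessTrace ℓ h) :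
    ∀ h h' : EuclideanSpace ℝ (Fin c),
      ℓ h' ≤ ℓ h + ‖gradient ℓ h‖ * ‖h' - h‖ +
        hessTrace ℓ h * (Real.exp (τ * ‖h' - h‖) - τ * ‖h' - h‖ - 1) / τ ^ 2 := by
  intro h h'
  have hsmooth2 : ContDiff ℝ 2 ℓ := hsmooth.of_le (by norm_num)
  have hdiff' : Differentiable ℝ (fderiv ℝ ℓ) :=
    (hsmooth2.fderiv_right (m := 1) (by norm_num)).differentiable (by norm_num)
  set v := h' - h with hv
  set r := ‖v‖
  set T := hessTrace ℓ h with hT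
  have htrace : ∀ t, 0 ≤ t → hessTrace ℓ (h + t • v) ≤ T * Real.exp (τ * r * t) := fun t ht => by
    have := le_mul_exp_of_hasDerivAt_le (K := τ * r)
      (hasDerivAt_comp_add_smul hsmooth.differentiable_hessTrace h v) (fun s => by
        refine (fderiv_apply_le_norm_gradient_mul _ _ _).trans ?_
        have := mul_le_mul_of_nonneg_right (hself (h + s • v)) (norm_nonneg v)
        linarith) ht
    simpa using this
  have hexp : ∀ t, HasDerivAt (fun s => Real.exp (τ * r * s))
      (Real.exp (τ * r * t) * (τ * r)) t :=
    fun t => by simpa using ((hasDerivAt_id t).const_mul (τ * r)).exp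
  have hderiv : ∀ t, 0 ≤ t →
      fderiv ℝ ℓ (h + t • v) v - T * r / τ * Real.exp (τ * r * t) ≤
        fderiv ℝ ℓ h v - T * r / τ := fun t ht => by
    have := le_of_hasDerivAt_nonpos
      (fun s => ((hasDerivAt_comp_add_smul hdiff' h v s).clm_apply (hasDerivAt_const s v)).sub
        ((hexp s).const_mul (T * r / τ))) (fun s hs => by
        have h1 := bilin_apply_self_le_trace_mul _
          (hconv.fderiv_fderiv_nonneg hsmooth2 (h + s • v)) v
        rw [← hessTrace_eq_sum_fderiv] at h1
        have h2 := mul_le_mul_of_nonneg_right (htrace s hs) (sq_nonneg r)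
        have h3 : T * r / τ * (Real.exp (τ * r * s) * (τ * r)) =
            T * Real.exp (τ * r * s) * r ^ 2 := by field_simp
        simp only [map_zero, add_zero]
        rw [h3]
        exact sub_nonpos.2 (h1.trans h2)) ht
    simpa using this
  have hvalue := le_of_hasDerivAt_nonpos
    (fun s => ((hasDerivAt_comp_add_smul (hsmooth.differentiable (by norm_num)) h v s).sub
      ((hexp s).const_mul (T / τ ^ 2))).sub
        ((hasDerivAt_id s).const_mul (fderiv ℝ ℓ h v - T * r / τ))) (fun s hs => by
      have h1 : T / τ ^ 2 * (Real.exp (τ * r * s) * (τ * r)) =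
          T * r / τ * Real.exp (τ * r * s) := by field_simp
      rw [h1]
      linarith [hderiv s hs]) zero_le_one
  have hgrad := fderiv_apply_le_norm_gradient_mul ℓ h v
  have hsplit : T * (Real.exp (τ * r) - τ * r - 1) / τ ^ 2 =
      T / τ ^ 2 * Real.exp (τ * r) - T * r / τ - T / τ ^ 2 := by field_simp
  simp only [Pi.sub_apply, one_smul, zero_smul, id, mul_one, mul_zero, add_zero, Real.exp_zero,
    hv, add_sub_cancel] at hvalue
  rw [hsplit]
  linarith
end
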